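/- arXiv:2102.02260 — 4 statements merged into one kernel-verified Lean document; each statement's English description precedes it below -/
import Mathlib

section
/- Let Ω be a finite nonempty set and let s be a strictly proper scoring rule on Ω. Suppose that the set S_s = { s(p) : p ∈ 𝒫 } of scores of probability functions equals the closure (in the product topology on [0,∞]^Ω) of the set F_s = S_s ∩ [0,∞)^Ω of finite scores of probability functions. Then for every credence function c ∈ 𝒞 \ 𝒫 there exists a probability function p ∈ 𝒫 such that s(p)(ω) < s(c)(ω) for every ω ∈ Ω. -/
open scoped ENNReal Classical

noncomputable section

/-- A credence function `p : 𝒫ow(Ω) → ℝ` satisfies the axioms of probability. -/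
def IsProb {Ω : Type*} [Fintype Ω] (p : Set Ω → ℝ) : Prop :=
  (∀ A : Set Ω, 0 ≤ p A) ∧ p Set.univ = 1 ∧
    ∀ A B : Set Ω, Disjoint A B → p (A ∪ B) = p A + p B

/-- Expectation `E_p f = Σ_{ω, p({ω}) ≠ 0} p({ω})·f(ω)`. -/
def expect {Ω : Type*} [Fintype Ω] (p : Set Ω → ℝ) (f : Ω → ℝ≥0∞) : ℝ≥0∞ :=
  ∑ ω ∈ Finset.univ.filter (fun ω => p {ω} ≠ 0), ENNReal.ofReal (p {ω}) * f ω

/-- A scoring rule `s : 𝒞 → [0,∞]^Ω` is strictly proper. -/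
def StrictlyProper {Ω : Type*} [Fintype Ω] (s : (Set Ω → ℝ) → Ω → ℝ≥0∞) : Prop :=
  ∀ p c : Set Ω → ℝ, IsProb p → c ≠ p → expect p (s p) < expect p (s c)

open Filter Topology

/-- The set function whose value at `A` is the total weight of the points of `A`. -/
def weightMeasure {Ω : Type*} [Fintype Ω] (w : Ω → ℝ) (A : Set Ω) : ℝ :=
  ∑ ω, if ω ∈ A then w ω else 0

/-- The sum of the values of `f` weighted by `w`, with `0 * ∞ = 0`. -/
def weightedSum {Ω : Type*} [Fintype Ω] (w : Ω → ℝ) (f : Ω → ℝ≥0∞) : ℝ≥0∞ :=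
  ∑ ω, ENNReal.ofReal (w ω) * f ω

section
variable {Ω : Type*} [Fintype Ω]

lemma weightMeasure_singleton (w : Ω → ℝ) (ω : Ω) : weightMeasure w {ω} = w ω := by
  simp [weightMeasure]

lemma isProb_weightMeasure {w : Ω → ℝ} (hw : w ∈ stdSimplex ℝ Ω) : IsProb (weightMeasure w) := by
  refine ⟨fun A => Finset.sum_nonneg fun ω _ => ?_, ?_, fun A B hAB => ?_⟩
  · split_ifs
    · exact hw.1 ω
    · exact le_rfl
  · simpa [weightMeasure] using hw.2
  · unfold weightMeasure
    rw [← Finset.sum_add_distrib]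
    refine Finset.sum_congr rfl fun ω _ => ?_
    have h : ω ∈ A → ω ∉ B := fun hA => Set.disjoint_left.1 hAB hA
    by_cases hA : ω ∈ A <;> by_cases hB : ω ∈ B <;> simp_all

lemma expect_weightMeasure (w : Ω → ℝ) (f : Ω → ℝ≥0∞) :
    expect (weightMeasure w) f = weightedSum w f := by
  simp only [expect, weightedSum, weightMeasure_singleton]
  refine Finset.sum_subset (Finset.filter_subset _ _) fun ω _ h => ?_
  have : w ω = 0 := by simpa using h
  simp [this]

lemma continuous_weightedSum_right (w : Ω → ℝ) : Continuous (weightedSum w) :=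
  continuous_finsetSum _ fun ω _ =>
    (ENNReal.continuous_const_mul ENNReal.ofReal_ne_top).comp (continuous_apply ω)

lemma continuous_weightedSum_left {f : Ω → ℝ≥0∞} (hf : ∀ ω, f ω ≠ ∞) :
    Continuous fun w => weightedSum w f :=
  continuous_finsetSum _ fun ω _ =>
    (ENNReal.continuous_mul_const (hf ω)).comp
      (ENNReal.continuous_ofReal.comp (continuous_apply ω))

lemma weightedSum_ne_top (w : Ω → ℝ) {f : Ω → ℝ≥0∞} (hf : ∀ ω, f ω ≠ ∞) :
    weightedSum w f ≠ ∞ :=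
  ENNReal.sum_ne_top.2 fun ω _ => ENNReal.mul_ne_top ENNReal.ofReal_ne_top (hf ω)

lemma continuous_toReal_weightedSum {f : Ω → ℝ≥0∞} (hf : ∀ ω, f ω ≠ ∞) :
    Continuous fun w => (weightedSum w f).toReal :=
  continuous_iff_continuousAt.2 fun w =>
    (ENNReal.tendsto_toReal (weightedSum_ne_top w hf)).comp
      (continuous_weightedSum_left hf).continuousAt

lemma weightedSum_mix {w : Ω → ℝ} (hw : ∀ ω, 0 ≤ w ω) (f : Ω → ℝ≥0∞) (ω : Ω) {t : ℝ}
    (h0 : 0 ≤ t) (h1 : t ≤ 1) :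
    weightedSum ((1 - t) • w + t • Pi.single ω (1 : ℝ)) f =
      ENNReal.ofReal (1 - t) * weightedSum w f + ENNReal.ofReal t * f ω := by
  have h (x : Ω) : ENNReal.ofReal (((1 - t) • w + t • Pi.single ω (1 : ℝ) : Ω → ℝ) x) * f x =
      ENNReal.ofReal (1 - t) * (ENNReal.ofReal (w x) * f x) +
        if x = ω then ENNReal.ofReal t * f ω else 0 := by
    have hs : 0 ≤ 1 - t := sub_nonneg.2 h1
    by_cases hx : x = ω
    · subst hx
      simp only [Pi.add_apply, Pi.smul_apply, smul_eq_mul, Pi.single_eq_same, mul_one, if_true]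
      rw [ENNReal.ofReal_add (mul_nonneg hs (hw x)) h0, ENNReal.ofReal_mul hs]
      ring
    · simp only [Pi.add_apply, Pi.smul_apply, smul_eq_mul, Pi.single_eq_of_ne hx, mul_zero,
        add_zero, if_neg hx]
      rw [ENNReal.ofReal_mul hs, mul_assoc]
  simp only [weightedSum]
  rw [Finset.sum_congr rfl fun x _ => h x, Finset.sum_add_distrib, Finset.mul_sum]
  simp

lemma mix_mem_stdSimplex {w : Ω → ℝ} (hw : w ∈ stdSimplex ℝ Ω) (ω : Ω) {t : ℝ}
    (h0 : 0 ≤ t) (h1 : t ≤ 1) :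
    (1 - t) • w + t • Pi.single ω (1 : ℝ) ∈ stdSimplex ℝ Ω :=
  convex_stdSimplex ℝ Ω hw (single_mem_stdSimplex ℝ ω) (sub_nonneg.2 h1) h0 (by ring)

/-- If every element `w` of the simplex gives `z` a larger weighted sum than some finite element
of `F`, then this remains true for some truncation of `z`. -/
lemma exists_truncation_weightedSum_lt {F : Set (Ω → ℝ≥0∞)} (hF : ∀ g ∈ F, ∀ ω, g ω ≠ ∞)
    {z : Ω → ℝ≥0∞} (hz : ∀ w ∈ stdSimplex ℝ Ω, ∃ g ∈ F, weightedSum w g < weightedSum w z) :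
    ∃ N : ℕ, ∀ w ∈ stdSimplex ℝ Ω,
      ∃ g ∈ F, weightedSum w g < weightedSum w fun ω => min (z ω) N := by
  have hfin (N : ℕ) (ω : Ω) : min (z ω) (N : ℝ≥0∞) ≠ ∞ :=
    ((min_le_right _ _).trans_lt (ENNReal.natCast_lt_top N)).ne
  obtain ⟨N, hN⟩ := (isCompact_stdSimplex ℝ Ω).elim_directed_cover
    (fun N : ℕ => ⋃ g ∈ F, {w | weightedSum w g < weightedSum w fun ω => min (z ω) N})
    (fun N => isOpen_biUnion fun g hg =>
      isOpen_lt (continuous_weightedSum_left (hF g hg)) (continuous_weightedSum_left (hfin N)))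
    (fun w hw => by
      obtain ⟨g, hg, hlt⟩ := hz w hw
      have hlim : Tendsto (fun N : ℕ => fun ω => min (z ω) (N : ℝ≥0∞)) atTop (𝓝 z) :=
        tendsto_pi_nhds.2 fun ω => by
          simpa using tendsto_const_nhds.min ENNReal.tendsto_nat_nhds_top
      obtain ⟨N, hN⟩ := ((((continuous_weightedSum_right w).tendsto z).comp hlim).eventually
        (lt_mem_nhds hlt)).exists
      simp only [Set.mem_iUnion]
      exact ⟨N, g, hg, hN⟩)
    (Monotone.directed_le fun M N hMN => Set.iUnion₂_mono fun g _ w hw =>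
      lt_of_lt_of_le (Set.mem_ofPred_eq ▸ hw) (Finset.sum_le_sum fun ω _ =>
        mul_le_mul_right (min_le_min_left _ (Nat.cast_le.2 hMN)) _))
  refine ⟨N, fun w hw => ?_⟩
  simpa using hN hw

/-- A family of scores indexed by the simplex, each minimizing its own weighted sum uniquely in the
closure of a set `F` of finite scores, is strictly below `z` at some point of the simplex
whenever each of its weighted sums is below that of `z`. -/
lemma exists_forall_lt_of_weightedSum_lt [Nonempty Ω] {F : Set (Ω → ℝ≥0∞)}
    (hF : ∀ g ∈ F, ∀ ω, g ω ≠ ∞) {σ : (Ω → ℝ) → Ω → ℝ≥0∞}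
    (hσ : ∀ w ∈ stdSimplex ℝ Ω, σ w ∈ closure F)
    (hmin : ∀ w ∈ stdSimplex ℝ Ω, ∀ f ∈ closure F, f ≠ σ w →
      weightedSum w (σ w) < weightedSum w f)
    {z : Ω → ℝ≥0∞} (hz : ∀ w ∈ stdSimplex ℝ Ω, weightedSum w (σ w) < weightedSum w z) :
    ∃ w ∈ stdSimplex ℝ Ω, ∀ ω, σ w ω < z ω := by
  have hle : ∀ w ∈ stdSimplex ℝ Ω, ∀ f ∈ closure F, weightedSum w (σ w) ≤ weightedSum w f := by
    intro w hw f hf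
    by_cases h : f = σ w
    · rw [h]
    · exact (hmin w hw f hf h).le
  have happrox : ∀ w ∈ stdSimplex ℝ Ω, ∀ a, weightedSum w (σ w) < a →
      ∃ g ∈ F, weightedSum w g < a := by
    intro w hw a ha
    obtain ⟨g, hga, hgF⟩ := mem_closure_iff.1 (hσ w hw) {f | weightedSum w f < a}
      (isOpen_lt (continuous_weightedSum_right w) continuous_const) ha
    exact ⟨g, hgF, hga⟩
  -- It is enough to consider finite `z`.
  wlog hfin : ∀ ω, z ω ≠ ∞ generalizing z
  · obtain ⟨N, hN⟩ := exists_truncation_weightedSum_lt hF fun w hw => happrox w hw _ (hz w hw)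
    obtain ⟨w, hw, h⟩ := this (z := fun ω => min (z ω) N)
      (fun w hw => by
        obtain ⟨g, hg, hlt⟩ := hN w hw
        exact (hle w hw g (subset_closure hg)).trans_lt hlt)
      (fun ω => ((min_le_right _ _).trans_lt (ENNReal.natCast_lt_top N)).ne)
    exact ⟨w, hw, fun ω => (h ω).trans_le (min_le_left _ _)⟩
  have hσtop : ∀ w ∈ stdSimplex ℝ Ω, weightedSum w (σ w) ≠ ∞ := fun w hw => (hz w hw).ne_top
  -- Minimize the expected gap between `z` and `σ w`.
  have hlsc : LowerSemicontinuousOn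
      (fun w => (weightedSum w z).toReal - (weightedSum w (σ w)).toReal) (stdSimplex ℝ Ω) := by
    intro w hw y hy
    obtain ⟨g, hg, hlt⟩ := happrox w hw
      (ENNReal.ofReal ((weightedSum w z).toReal - y))
      ((ENNReal.lt_ofReal_iff_toReal_lt (hσtop w hw)).2 (by linarith))
    have hlt' := (ENNReal.lt_ofReal_iff_toReal_lt (weightedSum_ne_top w (hF g hg))).1 hlt
    have hev := ((continuous_toReal_weightedSum hfin).sub
      (continuous_toReal_weightedSum (hF g hg))).continuousAt.eventually
      (lt_mem_nhds (show y < (weightedSum w z).toReal - (weightedSum w g).toReal by linarith))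
    filter_upwards [mem_nhdsWithin_of_mem_nhds hev, self_mem_nhdsWithin] with v hv hvs
    have := ENNReal.toReal_mono (weightedSum_ne_top v (hF g hg)) (hle v hvs g (subset_closure hg))
    simp only [Pi.sub_apply] at hv
    linarith
  obtain ⟨w, hw, hwmin⟩ := hlsc.exists_isMinOn
    ⟨_, single_mem_stdSimplex ℝ (Classical.arbitrary Ω)⟩ (isCompact_stdSimplex ℝ Ω)
  refine ⟨w, hw, fun ω => ?_⟩
  -- Move from the minimizer towards the vertex `ω`.
  let v : ℝ → Ω → ℝ := fun t => (1 - t) • w + t • Pi.single ω 1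
  have hvmem : ∀ t ∈ Set.Ioo (0 : ℝ) 1, v t ∈ stdSimplex ℝ Ω := fun t ht =>
    mix_mem_stdSimplex hw ω ht.1.le ht.2.le
  have hvsum : ∀ t ∈ Set.Ioo (0 : ℝ) 1, ∀ f, weightedSum (v t) f =
      ENNReal.ofReal (1 - t) * weightedSum w f + ENNReal.ofReal t * f ω := fun t ht f =>
    weightedSum_mix hw.1 f ω ht.1.le ht.2.le
  have hineq : ∀ t ∈ Set.Ioo (0 : ℝ) 1,
      σ (v t) ω + weightedSum w z ≤ z ω + weightedSum w (σ (v t)) := by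
    intro t ht
    have hs : 0 < 1 - t := sub_pos.2 ht.2
    have hG := hσtop _ (hvmem t ht)
    rw [hvsum t ht, ENNReal.add_ne_top] at hG
    have hA : weightedSum w (σ (v t)) ≠ ∞ := fun h => hG.1 (by
      rw [h, ENNReal.mul_top (ENNReal.ofReal_pos.2 hs).ne'])
    have hB : σ (v t) ω ≠ ∞ := fun h => hG.2 (by
      rw [h, ENNReal.mul_top (ENNReal.ofReal_pos.2 ht.1).ne'])
    have hZ := weightedSum_ne_top w hfin
    have h1 := hwmin (hvmem t ht)
    have h2 := ENNReal.toReal_mono hA (hle w hw _ (hσ _ (hvmem t ht)))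
    simp only [Set.mem_ofPred_eq, hvsum t ht] at h1
    rw [ENNReal.toReal_add hG.1 hG.2, ENNReal.toReal_add
      (ENNReal.mul_ne_top ENNReal.ofReal_ne_top hZ)
      (ENNReal.mul_ne_top ENNReal.ofReal_ne_top (hfin ω))] at h1
    simp only [ENNReal.toReal_mul, ENNReal.toReal_ofReal hs.le, ENNReal.toReal_ofReal ht.1.le] at h1
    rw [← ENNReal.toReal_le_toReal (ENNReal.add_ne_top.2 ⟨hB, hZ⟩)
      (ENNReal.add_ne_top.2 ⟨hfin ω, hA⟩), ENNReal.toReal_add hB hZ,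
      ENNReal.toReal_add (hfin ω) hA]
    refine le_of_mul_le_mul_left ?_ ht.1
    linarith
  let U : Ultrafilter ℝ := Ultrafilter.of (𝓝[>] (0 : ℝ))
  have hU : (U : Filter ℝ) ≤ 𝓝[>] 0 := Ultrafilter.of_le _
  have hIoo : ∀ᶠ t in (U : Filter ℝ), t ∈ Set.Ioo (0 : ℝ) 1 :=
    hU (Ioo_mem_nhdsGT zero_lt_one)
  have hU0 : (U : Filter ℝ) ≤ 𝓝 0 := hU.trans nhdsWithin_le_nhds
  obtain ⟨f, hf⟩ : ∃ f, Tendsto (fun t => σ (v t)) U (𝓝 f) := by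
    obtain ⟨f, -, hf⟩ := isCompact_univ.ultrafilter_le_nhds (U.map fun t => σ (v t)) (by simp)
    exact ⟨f, hf⟩
  have hfmem : f ∈ closure F := isClosed_closure.mem_of_tendsto hf
    (hIoo.mono fun t ht => hσ _ (hvmem t ht))
  have hfw : Tendsto (fun t => weightedSum w (σ (v t))) U (𝓝 (weightedSum w f)) :=
    ((continuous_weightedSum_right w).tendsto f).comp hf
  have hfle : ∀ g ∈ F, weightedSum w f ≤ weightedSum w g := by
    intro g hg
    have hone : Tendsto (fun t : ℝ => ENNReal.ofReal (1 - t)) U (𝓝 1) := by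
      have : Continuous fun t : ℝ => ENNReal.ofReal (1 - t) :=
        ENNReal.continuous_ofReal.comp (continuous_const.sub continuous_id)
      simpa using (this.tendsto 0).mono_left hU0
    have hl := ENNReal.Tendsto.mul hone (Or.inl one_ne_zero) hfw (Or.inr ENNReal.one_ne_top)
    have hv : Tendsto v U (𝓝 w) := by
      have : Continuous v := by fun_prop
      simpa [v] using (this.tendsto 0).mono_left hU0
    rw [one_mul] at hl
    refine le_of_tendsto_of_tendsto hl
      (((continuous_weightedSum_left (hF g hg)).tendsto w).comp hv) (hIoo.mono fun t ht => ?_)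
    have := hle _ (hvmem t ht) g (subset_closure hg)
    rw [hvsum t ht] at this
    exact le_self_add.trans this
  have hfeq : f = σ w := by
    by_contra hne
    obtain ⟨g, hg, hlt⟩ := happrox w hw _ (hmin w hw f hfmem hne)
    exact hlt.not_ge (hfle g hg)
  subst hfeq
  have hfinal : σ w ω + weightedSum w z ≤ z ω + weightedSum w (σ w) :=
    le_of_tendsto_of_tendsto ((tendsto_pi_nhds.1 hf ω).add tendsto_const_nhds)
      (tendsto_const_nhds.add hfw) (hIoo.mono hineq)
  by_contra! hge
  exact absurd (hz w hw) (not_lt.2 ((ENNReal.add_le_add_iff_left (hfin ω)).1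
    ((add_le_add_left hge _).trans hfinal)))

end

theorem stmt0 {Ω : Type*} [Fintype Ω] [Nonempty Ω]
    (s : (Set Ω → ℝ) → Ω → ℝ≥0∞) (hs : StrictlyProper s)
    (hcl : s '' {p | IsProb p} =
      closure ((s '' {p | IsProb p}) ∩ {f | ∀ ω, f ω ≠ ∞})) :
    ∀ c : Set Ω → ℝ, ¬ IsProb c →
      ∃ p : Set Ω → ℝ, IsProb p ∧ ∀ ω, s p ω < s c ω := by
  intro c hc
  obtain ⟨w, hw, h⟩ := exists_forall_lt_of_weightedSum_lt
    (F := (s '' {p | IsProb p}) ∩ {f | ∀ ω, f ω ≠ ∞}) (fun g hg => hg.2)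
    (σ := fun w => s (weightMeasure w)) (z := s c)
    (fun w hw => hcl ▸ ⟨_, isProb_weightMeasure hw, rfl⟩)
    (fun w hw f hf hne => by
      rw [← hcl] at hf
      obtain ⟨q, -, rfl⟩ := hf
      simpa only [expect_weightMeasure] using
        hs _ q (isProb_weightMeasure hw) fun h => hne (by rw [h]))
    (fun w hw => by
      simpa only [expect_weightMeasure] using
        hs _ c (isProb_weightMeasure hw) fun h => hc (h ▸ isProb_weightMeasure hw))
  exact ⟨_, isProb_weightMeasure hw, h⟩
end
end

section
/- Fix a point z ∈ [0,∞]^n and let D be a subset of ℝⁿ. Suppose that for every v in the non-positive orthant C = (-∞,0]^n the support function σ_D(v) = sup_{w ∈ D} ⟨w, v⟩ is finite, and let H_v = { w ∈ ℝⁿ : ⟨w, v⟩ ≤ σ_D(v) }. Suppose further that z lies in the extension (H_v°)* of the open half-space H_v° for every nonzero v ∈ C. Then there is a point z' in the convex hull of D such that z'_i < z_i for all i = 1, …, n. -/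
open scoped ENNReal Classical

noncomputable section

/-- The usual inner product on `ℝⁿ`. -/
def dotp {n : ℕ} (a b : Fin n → ℝ) : ℝ := ∑ i, a i * b i

/-- The extended inner product `⟨z, v⟩ = Σ_{i : z_i ≠ 0 and v_i ≠ 0} z_i·v_i`
for `z ∈ [0,∞]ⁿ` and `v ∈ ℝⁿ`, valued in the extended reals. -/
def eiprod {n : ℕ} (z : Fin n → ℝ≥0∞) (v : Fin n → ℝ) : EReal :=
  ∑ i ∈ Finset.univ.filter (fun i => z i ≠ 0 ∧ v i ≠ 0),
    ((z i : EReal) * ((v i : ℝ) : EReal))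

/-- The support function `σ_D(v) = sup_{w ∈ D} ⟨w, v⟩`, valued in the extended
reals (`⊥` for `D = ∅`, `⊤` if unbounded). -/
def suppFn {n : ℕ} (D : Set (Fin n → ℝ)) (v : Fin n → ℝ) : EReal :=
  sSup ((fun w => ((dotp w v : ℝ) : EReal)) '' D)

/-- The real points lying strictly below `z` in every coordinate. -/
def strictlyBelow {n : ℕ} (z : Fin n → ℝ≥0∞) : Set (Fin n → ℝ) :=
  {x | ∀ i, ((x i : ℝ) : EReal) < (z i : EReal)}

lemma strictlyBelow_eq_pi {n : ℕ} (z : Fin n → ℝ≥0∞) :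
    strictlyBelow z = Set.univ.pi fun i => {t : ℝ | (t : EReal) < (z i : EReal)} := by
  ext x
  simp [strictlyBelow]

lemma isOpen_strictlyBelow {n : ℕ} (z : Fin n → ℝ≥0∞) : IsOpen (strictlyBelow z) := by
  rw [strictlyBelow_eq_pi]
  exact isOpen_set_pi Set.finite_univ fun i _ =>
    isOpen_lt continuous_coe_real_ereal continuous_const

lemma convex_strictlyBelow {n : ℕ} (z : Fin n → ℝ≥0∞) : Convex ℝ (strictlyBelow z) := by
  rw [strictlyBelow_eq_pi]
  refine convex_pi fun i _ => Set.OrdConnected.convex ⟨fun x _ y hy t ht => ?_⟩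
  exact lt_of_le_of_lt (EReal.coe_le_coe_iff.2 ht.2) hy

lemma coe_lt_coe_ennreal_of_neg {t : ℝ} (ht : t < 0) (a : ℝ≥0∞) :
    (t : EReal) < (a : EReal) :=
  lt_of_lt_of_le (EReal.coe_lt_coe_iff.2 ht) (EReal.coe_ennreal_nonneg a)

lemma toReal_sub_mem_strictlyBelow {n : ℕ} (z : Fin n → ℝ≥0∞) {ε : ℝ} (hε : 0 < ε) :
    (fun i => (z i).toReal - ε) ∈ strictlyBelow z := by
  intro i
  by_cases h : z i = ⊤
  · simp only [h, EReal.coe_ennreal_top]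
    exact EReal.coe_lt_top _
  · rw [← EReal.coe_toReal (x := (z i : EReal)) (by simpa using h)
      (EReal.coe_ennreal_ne_bot _), EReal.toReal_coe_ennreal]
    exact EReal.coe_lt_coe_iff.2 (by linarith)

lemma update_mem_strictlyBelow {n : ℕ} {z : Fin n → ℝ≥0∞} {i : Fin n} {t : ℝ}
    (ht : (t : EReal) < (z i : EReal)) :
    Function.update (fun _ => (-1 : ℝ)) i t ∈ strictlyBelow z := by
  intro j
  by_cases h : j = i
  · subst h
    simpa using ht
  · rw [Function.update_of_ne h]
    exact coe_lt_coe_ennreal_of_neg (by norm_num) _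

lemma dotp_update {n : ℕ} (x g : Fin n → ℝ) (i : Fin n) (t : ℝ) :
    dotp (Function.update x i t) g = dotp x g + (t - x i) * g i := by
  have h : ∀ j, Function.update x i t j * g j
      = x j * g j + if j = i then (t - x i) * g i else 0 := by
    intro j
    by_cases h : j = i
    · subst h
      simp
      ring
    · simp [h]
  simp only [dotp, h, Finset.sum_add_distrib, Finset.sum_ite_eq', Finset.mem_univ, if_true]

lemma dotp_neg_right {n : ℕ} (x g : Fin n → ℝ) : dotp x (-g) = -dotp x g := by
  simp [dotp]

/-- A functional bounded above on `strictlyBelow z` has nonnegative coefficients. -/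
lemma nonneg_of_dotp_lt {n : ℕ} {z : Fin n → ℝ≥0∞} {g : Fin n → ℝ} {u : ℝ}
    (hg : ∀ x ∈ strictlyBelow z, dotp x g < u) (i : Fin n) : 0 ≤ g i := by
  by_contra! hi
  set c := dotp (fun _ => (-1 : ℝ)) g
  have key := hg _ (update_mem_strictlyBelow (z := z) (i := i) (t := -1 - (|u - c| / (-g i)))
    (coe_lt_coe_ennreal_of_neg
      (by have : 0 ≤ |u - c| / (-g i) := div_nonneg (abs_nonneg _) (by linarith)
          linarith) _))
  rw [dotp_update] at key
  have : (-1 - |u - c| / (-g i) - (-1)) * g i = |u - c| := by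
    field_simp [hi.ne]
    ring
  rw [this] at key
  linarith [le_abs_self (u - c)]

/-- A functional bounded above on `strictlyBelow z` vanishes in the infinite directions of `z`. -/
lemma eq_zero_of_dotp_lt {n : ℕ} {z : Fin n → ℝ≥0∞} {g : Fin n → ℝ} {u : ℝ}
    (hg : ∀ x ∈ strictlyBelow z, dotp x g < u) {i : Fin n} (hi : z i = ⊤) : g i = 0 := by
  by_contra h
  set c := dotp (fun _ => (-1 : ℝ)) g
  have key := hg _ (update_mem_strictlyBelow (z := z) (i := i) (t := -1 + (u - c) / g i)
    (by rw [hi, EReal.coe_ennreal_top]; exact EReal.coe_lt_top _))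
  rw [dotp_update] at key
  have : (-1 + (u - c) / g i - (-1)) * g i = u - c := by
    field_simp
    ring
  rw [this] at key
  linarith

lemma dotp_toReal_le {n : ℕ} {z : Fin n → ℝ≥0∞} {g : Fin n → ℝ} {u : ℝ}
    (hg : ∀ x ∈ strictlyBelow z, dotp x g < u) : dotp (fun i => (z i).toReal) g ≤ u := by
  have hlim : Filter.Tendsto (fun ε : ℝ => dotp (fun i => (z i).toReal - ε) g)
      (nhdsWithin 0 (Set.Ioi 0)) (nhds (dotp (fun i => (z i).toReal) g)) := by
    have : Continuous fun ε : ℝ => dotp (fun i => (z i).toReal - ε) g := by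
      unfold dotp
      fun_prop
    simpa using (this.tendsto 0).mono_left nhdsWithin_le_nhds
  refine le_of_tendsto hlim ?_
  filter_upwards [self_mem_nhdsWithin] with ε hε
  exact (hg _ (toReal_sub_mem_strictlyBelow z hε)).le

/-- If `v` vanishes where `z` is infinite, the extended inner product is the usual one. -/
lemma eiprod_eq_coe_dotp {n : ℕ} {z : Fin n → ℝ≥0∞} {v : Fin n → ℝ}
    (hv : ∀ i, z i = ⊤ → v i = 0) :
    eiprod z v = ((dotp (fun i => (z i).toReal) v : ℝ) : EReal) := by
  have hcoe : ∀ (s : Finset (Fin n)) (f : Fin n → ℝ),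
      ((∑ i ∈ s, f i : ℝ) : EReal) = ∑ i ∈ s, (f i : EReal) := fun s f =>
    map_sum (⟨⟨Real.toEReal, EReal.coe_zero⟩, EReal.coe_add⟩ : ℝ →+ EReal) f s
  rw [eiprod, dotp, hcoe, Finset.sum_filter]
  refine Finset.sum_congr rfl fun i _ => ?_
  by_cases h : z i ≠ 0 ∧ v i ≠ 0
  · rw [if_pos h, EReal.coe_mul, ← EReal.toReal_coe_ennreal,
      EReal.coe_toReal (by simpa using fun ht => h.2 (hv i ht)) (EReal.coe_ennreal_ne_bot _)]
  · rw [if_neg h]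
    by_cases h0 : z i = 0
    · simp [h0]
    · simp [show v i = 0 by tauto]

/-- Lemma 1 (cone lemma 1): if `σ_D(v)` is finite for all `v` in the non-positive
orthant `C`, and `z ∈ (H_v°)*` for every nonzero `v ∈ C` (i.e. there is a point `w`
of the open half-space `H_v° = {w : ⟨w,v⟩ < σ_D(v)}` with `⟨z,v⟩ ≤ ⟨w,v⟩`), then
some `z'` in the convex hull of `D` satisfies `z'_i < z_i` for all `i`. -/
theorem stmt2 {n : ℕ} (z : Fin n → ℝ≥0∞) (D : Set (Fin n → ℝ))
    (hfin : ∀ v : Fin n → ℝ, (∀ i, v i ≤ 0) → suppFn D v ≠ ⊤ ∧ suppFn D v ≠ ⊥)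
    (hz : ∀ v : Fin n → ℝ, (∀ i, v i ≤ 0) → v ≠ 0 →
      ∃ w : Fin n → ℝ, ((dotp w v : ℝ) : EReal) < suppFn D v ∧
        eiprod z v ≤ ((dotp w v : ℝ) : EReal)) :
    ∃ z' ∈ convexHull ℝ D, ∀ i, ((z' i : ℝ) : EReal) < (z i : EReal) := by
  by_contra hcon
  have hDne : D.Nonempty := by
    by_contra h
    rw [Set.not_nonempty_iff_eq_empty] at h
    exact (hfin 0 fun _ => le_rfl).2 (by simp [suppFn, h])
  obtain ⟨d, hd⟩ := hDne
  have hdisj : Disjoint (strictlyBelow z) (convexHull ℝ D) :=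
    Set.disjoint_left.2 fun x hx hxD => hcon ⟨x, hxD, hx⟩
  obtain ⟨f, u, hfu, huf⟩ := geometric_hahn_banach_open (convex_strictlyBelow z)
    (isOpen_strictlyBelow z) (convex_convexHull ℝ D) hdisj
  set g : Fin n → ℝ := fun i => f (Pi.single i 1) with hgdef
  have hf : ∀ x, f x = dotp x g := fun x => by
    conv_lhs => rw [pi_eq_sum_univ' x, map_sum]
    simp [dotp, hgdef]
  have hg : ∀ x ∈ strictlyBelow z, dotp x g < u := fun x hx => hf x ▸ hfu x hx
  have huD : ∀ w ∈ D, u ≤ dotp w g := fun w hw => hf w ▸ huf w (subset_convexHull ℝ D hw)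
  have hg0 : -g ≠ 0 := fun h => by
    have h1 := hg _ (toReal_sub_mem_strictlyBelow z one_pos)
    have h2 := huD d hd
    rw [neg_eq_zero.1 h] at h1 h2
    simp only [dotp, Pi.zero_apply, mul_zero, Finset.sum_const_zero] at h1 h2
    linarith
  obtain ⟨w, hw, hzw⟩ := hz (-g) (fun i => neg_nonpos.2 (nonneg_of_dotp_lt hg i)) hg0
  have hsupp : suppFn D (-g) ≤ ((-u : ℝ) : EReal) := by
    refine sSup_le ?_
    rintro _ ⟨x, hx, rfl⟩
    rw [EReal.coe_le_coe_iff, dotp_neg_right]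
    exact neg_le_neg (huD x hx)
  have hu : ((-u : ℝ) : EReal) ≤ eiprod z (-g) := by
    rw [eiprod_eq_coe_dotp fun i hi => by simp [eq_zero_of_dotp_lt hg hi],
      EReal.coe_le_coe_iff, dotp_neg_right]
    exact neg_le_neg (dotp_toReal_le hg)
  exact absurd hw (not_lt.2 (hsupp.trans (hu.trans hzw)))
end
end

section
/- Let D be a closed subset of ℝⁿ such that for every nonzero v in the non-positive orthant C = (-∞,0]ⁿ there is a unique closed half-space H_v with outward normal v such that D ⊆ H_v and the boundary of H_v intersects D in exactly one point. Then for every z in the convex hull of D there exists z' ∈ D such that z'_i ≤ z_i for all i = 1, …, n. -/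
noncomputable section

open Filter Topology

/-- `x` is the only minimizer of the linear functional `⟨·, u⟩` over `D`. -/
def IsUniqueMinimizer {ι : Type*} [Fintype ι] (D : Set (ι → ℝ)) (u x : ι → ℝ) : Prop :=
  x ∈ D ∧ (∀ w ∈ D, x ⬝ᵥ u ≤ w ⬝ᵥ u) ∧ ∀ y ∈ D, y ⬝ᵥ u ≤ x ⬝ᵥ u → y = x

theorem le_of_mem_convexHull_of_le {ι : Type*} {D : Set (ι → ℝ)} {m z : ι → ℝ}
    (hm : ∀ w ∈ D, m ≤ w) (hz : z ∈ convexHull ℝ D) : m ≤ z :=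
  convexHull_min hm (convex_Ici m) hz

theorem Filter.Tendsto.dotProduct_of_real {α ι : Type*} [Fintype ι] {l : Filter α}
    {f g : α → ι → ℝ} {a b : ι → ℝ} (hf : Tendsto f l (𝓝 a)) (hg : Tendsto g l (𝓝 b)) :
    Tendsto (fun k => f k ⬝ᵥ g k) l (𝓝 (a ⬝ᵥ b)) :=
  tendsto_finsetSum _ fun i _ => (tendsto_pi_nhds.1 hf i).mul (tendsto_pi_nhds.1 hg i)

section

variable {ι : Type*} [Fintype ι] {D : Set (ι → ℝ)} {m z : ι → ℝ}

theorem IsUniqueMinimizer.le_of_mem_convexHull {u x : ι → ℝ} (hx : IsUniqueMinimizer D u x)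
    (hz : z ∈ convexHull ℝ D) : x ⬝ᵥ u ≤ z ⬝ᵥ u := by
  have hconv : Convex ℝ {w : ι → ℝ | x ⬝ᵥ u ≤ w ⬝ᵥ u} :=
    convex_halfSpace_ge ⟨fun a b => add_dotProduct a b u, fun c a => smul_dotProduct c a u⟩ _
  exact convexHull_min hx.2.1 hconv hz

/-- A point of a lower-bounded region whose pairing with `u ≥ ε` is controlled is bounded. -/
theorem apply_le_of_dotProduct_le {ε : ℝ} (hε : 0 < ε) {s x : ι → ℝ} (hs : s ∈ stdSimplex ℝ ι)
    (hmx : m ≤ x) (hmz : m ≤ z) (h : x ⬝ᵥ (s + ε • 1) ≤ z ⬝ᵥ (s + ε • 1)) (i : ι) :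
    x i ≤ m i + (∑ j, (z j - m j)) * (1 + ε) / ε := by
  have hle : (x i - m i) * ε ≤ (∑ j, (z j - m j)) * (1 + ε) := by
    calc (x i - m i) * ε ≤ (x i - m i) * (s i + ε) :=
          mul_le_mul_of_nonneg_left (by linarith [hs.1 i]) (sub_nonneg.2 (hmx i))
      _ ≤ ∑ j, (x j - m j) * (s j + ε) :=
          Finset.single_le_sum (f := fun j => (x j - m j) * (s j + ε))
            (fun j _ => mul_nonneg (sub_nonneg.2 (hmx j)) (by linarith [hs.1 j]))
            (Finset.mem_univ i)
      _ ≤ ∑ j, (z j - m j) * (s j + ε) := by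
          simp only [dotProduct, Pi.add_apply, Pi.smul_apply, Pi.one_apply, smul_eq_mul,
            mul_one] at h
          simp only [sub_mul, Finset.sum_sub_distrib]
          linarith
      _ ≤ (∑ j, (z j - m j)) * (1 + ε) := by
          rw [Finset.sum_mul]
          refine Finset.sum_le_sum fun j _ => mul_le_mul_of_nonneg_left ?_ (sub_nonneg.2 (hmz j))
          have : s j ≤ 1 := (mem_Icc_of_mem_stdSimplex hs j).2
          linarith
  rw [← sub_le_iff_le_add', le_div_iff₀ hε]
  exact hle

/-- Approximate domination: the maximizer `s` over the simplex of the concave function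
`s ↦ min_{w ∈ D} ⟨w - z, s + ε⟩` has a minimizer `x ∈ D` satisfying the first order conditions. -/
theorem exists_mem_dotProduct_single_add_le [DecidableEq ι] [Nonempty ι] (hD : IsClosed D)
    (hm : ∀ w ∈ D, m ≤ w) (hmin : ∀ u : ι → ℝ, (∀ i, 0 < u i) → ∃ x, IsUniqueMinimizer D u x)
    (hz : z ∈ convexHull ℝ D) {ε : ℝ} (hε : 0 < ε) :
    ∃ x ∈ D, ∀ i, (x - z) ⬝ᵥ (Pi.single i 1 + ε • 1) ≤ 0 := by
  have hmz := le_of_mem_convexHull_of_le hm hz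
  have hpos : ∀ s ∈ stdSimplex ℝ ι, ∀ i, 0 < (s + ε • (1 : ι → ℝ)) i := fun s hs i => by
    simpa using add_pos_of_nonneg_of_pos (hs.1 i) hε
  choose! x hx using fun s (hs : s ∈ stdSimplex ℝ ι) => hmin _ (hpos s hs)
  set h : (ι → ℝ) → ℝ := fun s => (x s - z) ⬝ᵥ (s + ε • 1) with hh
  have husc : UpperSemicontinuousOn h (stdSimplex ℝ ι) := by
    intro s hs c hc
    have hcont : Continuous fun t : ι → ℝ => (x s - z) ⬝ᵥ (t + ε • 1) := by
      unfold dotProduct; fun_prop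
    filter_upwards [mem_nhdsWithin_of_mem_nhds (hcont.continuousAt.eventually_lt_const hc),
      self_mem_nhdsWithin] with t ht hts
    refine lt_of_le_of_lt ?_ ht
    have := (hx t hts).2.1 _ (hx s hs).1
    simp only [hh, sub_dotProduct]
    linarith
  obtain ⟨s, hs, hsmax⟩ := husc.exists_isMaxOn
    ⟨_, single_mem_stdSimplex ℝ (Classical.arbitrary ι)⟩ (isCompact_stdSimplex ℝ ι)
  refine ⟨x s, (hx s hs).1, fun i => ?_⟩
  have hh0 : ∀ t ∈ stdSimplex ℝ ι, h t ≤ 0 := fun t ht => by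
    have := (hx t ht).le_of_mem_convexHull hz
    simp only [hh, sub_dotProduct]
    linarith
  let τ : ℕ → ℝ := fun k => 1 / ((k : ℝ) + 1)
  have hτ : Tendsto τ atTop (𝓝 0) := tendsto_one_div_add_atTop_nhds_zero_nat
  have hτ0 : ∀ k, 0 < τ k := fun k => Nat.one_div_pos_of_nat
  have hτ1 : ∀ k, τ k ≤ 1 := fun k => by
    refine div_le_one_of_le₀ ?_ ?_ <;> linarith [Nat.cast_nonneg (α := ℝ) k]
  let p : ℕ → ι → ℝ := fun k => (1 - τ k) • s + τ k • Pi.single i 1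
  have hp : ∀ k, p k ∈ stdSimplex ℝ ι := fun k =>
    convex_stdSimplex ℝ ι hs (single_mem_stdSimplex ℝ i) (by linarith [hτ1 k]) (hτ0 k).le
      (by ring)
  have hplim : Tendsto p atTop (𝓝 s) := by
    have : Tendsto p atTop (𝓝 ((1 - (0 : ℝ)) • s + (0 : ℝ) • Pi.single i 1)) :=
      ((hτ.const_sub 1).smul_const s).add (hτ.smul_const _)
    simpa using this
  have hcompact : IsCompact (D ∩ Set.Icc m (fun i => m i + (∑ j, (z j - m j)) * (1 + ε) / ε)) :=
    isCompact_Icc.inter_left hD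
  obtain ⟨y, hy, φ, hφ, hlim⟩ := hcompact.tendsto_subseq (x := fun k => x (p k)) fun k =>
    ⟨(hx _ (hp k)).1, hm _ (hx _ (hp k)).1, apply_le_of_dotProduct_le hε (hp k)
      (hm _ (hx _ (hp k)).1) hmz ((hx _ (hp k)).le_of_mem_convexHull hz)⟩
  have hval : Tendsto (fun k => h (p (φ k))) atTop (𝓝 ((y - z) ⬝ᵥ (s + ε • 1))) := by
    exact (hlim.sub_const z).dotProduct_of_real ((hplim.comp hφ.tendsto_atTop).add_const _)
  have hyx : y = x s := by
    refine (hx s hs).2.2 y hy.1 ?_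
    have := le_of_tendsto hval (Eventually.of_forall fun k => hsmax (hp (φ k)))
    simp only [hh, sub_dotProduct] at this
    linarith
  rw [← hyx]
  refine le_of_tendsto ((hlim.sub_const z).dotProduct_of_real tendsto_const_nhds)
    (Eventually.of_forall fun k => ?_)
  change (x (p (φ k)) - z) ⬝ᵥ _ ≤ 0
  set t := τ (φ k)
  set w := x (p (φ k)) with hw
  have hdecomp : p (φ k) + ε • 1 = (1 - t) • (s + ε • 1) + t • (Pi.single i 1 + ε • 1) := by
    simp only [p]; module
  have hmax : h (p (φ k)) ≤ h s := hsmax (hp (φ k))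
  have hle : h s ≤ (w - z) ⬝ᵥ (s + ε • 1) := by
    have := (hx s hs).2.1 w (hx _ (hp (φ k))).1
    simp only [hh, sub_dotProduct]
    linarith
  have heq : h (p (φ k)) = (1 - t) * ((w - z) ⬝ᵥ (s + ε • 1))
      + t * ((w - z) ⬝ᵥ (Pi.single i 1 + ε • 1)) := by
    simp only [hh]
    rw [← hw, hdecomp, dotProduct_add, dotProduct_smul, dotProduct_smul, smul_eq_mul, smul_eq_mul]
  have hmul := mul_le_mul_of_nonneg_left hle (sub_nonneg.2 (hτ1 (φ k)))
  have : t * ((w - z) ⬝ᵥ (Pi.single i 1 + ε • 1)) ≤ t * h s := by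
    change (1 - t) * _ ≤ (1 - t) * _ at hmul
    linarith
  exact (le_of_mul_le_mul_left this (hτ0 _)).trans (hh0 s hs)

/-- A closed, lower-bounded set on which every positive functional has a unique minimizer
contains, for each point of its convex hull, a point below it. -/
theorem exists_mem_le_of_mem_convexHull [Nonempty ι] (hD : IsClosed D) (hm : ∀ w ∈ D, m ≤ w)
    (hmin : ∀ u : ι → ℝ, (∀ i, 0 < u i) → ∃ x, IsUniqueMinimizer D u x)
    (hz : z ∈ convexHull ℝ D) : ∃ x ∈ D, x ≤ z := by
  classical
  have hmz := le_of_mem_convexHull_of_le hm hz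
  let τ : ℕ → ℝ := fun k => 1 / ((k : ℝ) + 1)
  have hτ : Tendsto τ atTop (𝓝 0) := tendsto_one_div_add_atTop_nhds_zero_nat
  have hτ0 : ∀ k, 0 < τ k := fun k => Nat.one_div_pos_of_nat
  have hτ1 : ∀ k, τ k ≤ 1 := fun k => by
    refine div_le_one_of_le₀ ?_ ?_ <;> linarith [Nat.cast_nonneg (α := ℝ) k]
  choose x hxD hx using fun k => exists_mem_dotProduct_single_add_le hD hm hmin hz (hτ0 k)
  set M : ℝ := ∑ j, (z j - m j) with hM
  have hM0 : 0 ≤ M := Finset.sum_nonneg fun j _ => sub_nonneg.2 (hmz j)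
  have hxle : ∀ k i, x k i ≤ z i + τ k * M := fun k i => by
    have h1 := hx k i
    rw [dotProduct_add, dotProduct_smul, dotProduct_single_one, dotProduct_one, smul_eq_mul,
      Pi.sub_apply] at h1
    have h2 : -M ≤ ∑ j, (x k - z) j := by
      rw [hM, ← Finset.sum_neg_distrib]
      refine Finset.sum_le_sum fun j _ => ?_
      have : m j ≤ x k j := hm _ (hxD k) j
      simp only [Pi.sub_apply]
      linarith
    have := mul_le_mul_of_nonneg_left h2 (hτ0 k).le
    linarith
  obtain ⟨y, hy, φ, hφ, hlim⟩ :=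
    (isCompact_Icc.inter_left hD : IsCompact (D ∩ Set.Icc m (fun i => z i + M))).tendsto_subseq
      (x := x) fun k => ⟨hxD k, hm _ (hxD k), fun i => (hxle k i).trans <| by
        have := mul_le_mul_of_nonneg_right (hτ1 k) hM0
        linarith⟩
  refine ⟨y, hy.1, fun i => ?_⟩
  have hbound : Tendsto (fun k => z i + τ (φ k) * M) atTop (𝓝 (z i)) := by
    simpa using ((hτ.comp hφ.tendsto_atTop).mul_const M).const_add (z i)
  exact le_of_tendsto_of_tendsto' (tendsto_pi_nhds.1 hlim i) hbound fun k => hxle (φ k) i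

end

/-- Lemma 2 (cone lemma 2): if `D ⊆ ℝⁿ` is closed and for every nonzero `v` in the
non-positive orthant there is a unique closed half-space `{w : ⟨w,v⟩ ≤ a}` with
outward normal `v` containing `D` whose boundary hyperplane `{w : ⟨w,v⟩ = a}`
meets `D` in exactly one point, then every `z` in the convex hull of `D` is
coordinatewise dominated by some `z' ∈ D`. -/
theorem stmt3 {n : ℕ} (D : Set (Fin n → ℝ)) (hD : IsClosed D)
    (hH : ∀ v : Fin n → ℝ, (∀ i, v i ≤ 0) → v ≠ 0 →
      ∃! a : ℝ, (∀ w ∈ D, dotp w v ≤ a) ∧ (∃! w : Fin n → ℝ, w ∈ D ∧ dotp w v = a)) :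
    ∀ z ∈ convexHull ℝ D, ∃ z' ∈ D, ∀ i, z' i ≤ z i := by
  intro z hz
  have hmin : ∀ u : Fin n → ℝ, (∀ i, 0 ≤ u i) → u ≠ 0 → ∃ x, IsUniqueMinimizer D u x := by
    intro u hu hu0
    obtain ⟨a, ⟨hle, x, ⟨hxD, hxa⟩, huniq⟩, -⟩ :=
      hH (-u) (fun i => neg_nonpos.2 (hu i)) (neg_ne_zero.2 hu0)
    have hneg : ∀ w, dotp w (-u) = -(w ⬝ᵥ u) := fun w => dotProduct_neg w u
    simp only [hneg] at hle hxa huniq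
    refine ⟨x, hxD, fun w hw => by linarith [hle w hw], fun y hy hyx => huniq y ⟨hy, ?_⟩⟩
    linarith [hle y hy]
  choose x hx using fun i : Fin n => hmin (Pi.single i 1) (fun j => by
    by_cases h : j = i <;> simp [h]) (by simp)
  have hm : ∀ w ∈ D, (fun i => x i i) ≤ w := fun w hw i => by
    simpa using (hx i).2.1 w hw
  rcases isEmpty_or_nonempty (Fin n) with hn | hn
  · obtain ⟨y, hy⟩ := convexHull_nonempty_iff.1 ⟨z, hz⟩
    exact ⟨y, hy, fun i => isEmptyElim i⟩
  exact exists_mem_le_of_mem_convexHull hD hm (fun u hu => hmin u (fun i => (hu i).le)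
    fun h => by simpa [h] using hu (Classical.arbitrary _)) hz
end
end

section
/- Let Ω be a finite nonempty set and let s be a strictly proper scoring rule on Ω that is continuous on probabilities. Then the set S_s = { s(p) : p ∈ 𝒫 } is compact in [0,∞]^Ω (product topology) and equals the closure of the set F_s = S_s ∩ [0,∞)^Ω of finite scores of probability functions. -/
open scoped ENNReal Classical

noncomputable section

/-- For `v` in the simplex, `p_v` is the probability with `p_v({ω}) = v ω`,
extended additively: `p_v(A) = Σ_{ω ∈ A} v ω`. -/
def probOf {Ω : Type*} [Fintype Ω] (v : Ω → ℝ) : Set Ω → ℝ :=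
  fun A => ∑ ω ∈ Finset.univ.filter (· ∈ A), v ω

/-- The scoring rule is continuous on probabilities: `v ↦ s(p_v)` is continuous
on the simplex `T`, with `[0,∞]^Ω` carrying the product topology. -/
def ContinuousOnProbs {Ω : Type*} [Fintype Ω] (s : (Set Ω → ℝ) → Ω → ℝ≥0∞) : Prop :=
  ContinuousOn (fun v : Ω → ℝ => s (probOf v)) (stdSimplex ℝ Ω)

theorem probOf_singleton {Ω : Type*} [Fintype Ω] (v : Ω → ℝ) (ω : Ω) :
    probOf v {ω} = v ω := by
  simp [probOf, Finset.sum_filter]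

theorem isProb_probOf {Ω : Type*} [Fintype Ω] {v : Ω → ℝ} (hv : v ∈ stdSimplex ℝ Ω) :
    IsProb (probOf v) := by
  refine ⟨fun A => Finset.sum_nonneg fun ω _ => hv.1 ω, ?_, fun A B hAB => ?_⟩
  · simpa [probOf] using hv.2
  · simp only [probOf, Set.mem_union]
    rw [Finset.filter_or, Finset.sum_union]
    exact Finset.disjoint_filter.2 fun ω _ hA hB => Set.disjoint_left.1 hAB hA hB

theorem IsProb.eq_sum_singleton {Ω : Type*} [Fintype Ω] {p : Set Ω → ℝ} (hp : IsProb p)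
    (F : Finset Ω) : p F = ∑ ω ∈ F, p {ω} := by
  induction F using Finset.induction_on with
  | empty => simpa using hp.2.2 ∅ ∅ (Set.disjoint_empty ∅)
  | insert a F ha ih =>
    rw [Finset.sum_insert ha, Finset.coe_insert, Set.insert_eq,
      hp.2.2 _ _ (by simpa using ha), ih]

theorem IsProb.probOf_eq {Ω : Type*} [Fintype Ω] {p : Set Ω → ℝ} (hp : IsProb p) :
    probOf (fun ω => p {ω}) = p := by
  funext A
  rw [probOf, ← hp.eq_sum_singleton]
  simp

theorem IsProb.mem_stdSimplex {Ω : Type*} [Fintype Ω] {p : Set Ω → ℝ} (hp : IsProb p) :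
    (fun ω => p {ω}) ∈ stdSimplex ℝ Ω :=
  ⟨fun _ => hp.1 _, by rw [← hp.eq_sum_singleton, Finset.coe_univ, hp.2.1]⟩

theorem image_probOf_stdSimplex {Ω : Type*} [Fintype Ω] :
    probOf '' stdSimplex ℝ Ω = {p | IsProb p} := by
  ext p
  constructor
  · rintro ⟨v, hv, rfl⟩
    exact isProb_probOf hv
  · exact fun hp => ⟨_, hp.mem_stdSimplex, hp.probOf_eq⟩

/-- A strictly proper score of a probability `p` is finite wherever `p` is nonzero. -/
theorem StrictlyProper.ne_top {Ω : Type*} [Fintype Ω] {s : (Set Ω → ℝ) → Ω → ℝ≥0∞}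
    (hs : StrictlyProper s) {p : Set Ω → ℝ} (hp : IsProb p) {ω : Ω} (hω : p {ω} ≠ 0) :
    s p ω ≠ ∞ := by
  have hne : (fun A => p A + 1) ≠ p := fun h => by simpa using congrFun h ∅
  intro htop
  have hpos : ENNReal.ofReal (p {ω}) ≠ 0 := by
    simpa using lt_of_le_of_ne (hp.1 {ω}) hω.symm
  have hterm := ENNReal.sum_ne_top.1 (hs p _ hp hne).ne_top ω
    (Finset.mem_filter.2 ⟨Finset.mem_univ ω, hω⟩)
  rw [htop] at hterm
  exact hterm (ENNReal.mul_top hpos)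

theorem stdSimplex_subset_closure_pos {Ω : Type*} [Fintype Ω] [Nonempty Ω] :
    stdSimplex ℝ Ω ⊆ closure {v | v ∈ stdSimplex ℝ Ω ∧ ∀ ω, 0 < v ω} := by
  intro v hv
  have hcard : (0 : ℝ) < Fintype.card Ω := by exact_mod_cast Fintype.card_pos
  let u : Ω → ℝ := fun _ => (Fintype.card Ω : ℝ)⁻¹
  have hu : u ∈ stdSimplex ℝ Ω :=
    ⟨fun _ => (inv_pos.2 hcard).le, by simp [u, hcard.ne']⟩
  refine closure_mono ?_ (segment_subset_closure_openSegment (left_mem_segment ℝ v u))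
  intro w hw
  refine ⟨(convex_stdSimplex ℝ Ω).openSegment_subset hv hu hw, fun ω => ?_⟩
  obtain ⟨a, b, ha, hb, -, rfl⟩ := hw
  exact add_pos_of_nonneg_of_pos (mul_nonneg ha.le (hv.1 ω)) (mul_pos hb (inv_pos.2 hcard))

/-- If `s` is strictly proper and continuous on probabilities, then the set
`S_s = s[𝒫]` of scores of probabilities is compact in `[0,∞]^Ω` and equals the
closure of its subset `F_s` of finite scores. -/
theorem stmt5 {Ω : Type*} [Fintype Ω] [Nonempty Ω]
    (s : (Set Ω → ℝ) → Ω → ℝ≥0∞) (hs : StrictlyProper s)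
    (hcont : ContinuousOnProbs s) :
    IsCompact (s '' {p | IsProb p}) ∧
      s '' {p | IsProb p} =
        closure ((s '' {p | IsProb p}) ∩ {f | ∀ ω, f ω ≠ ∞}) := by
  have himage : s '' {p | IsProb p} = (fun v => s (probOf v)) '' stdSimplex ℝ Ω := by
    rw [← image_probOf_stdSimplex, Set.image_image]
  have hcompact : IsCompact (s '' {p | IsProb p}) := by
    rw [himage]
    exact (isCompact_stdSimplex ℝ Ω).image_of_continuousOn hcont
  refine ⟨hcompact, Set.Subset.antisymm ?_
    (closure_minimal Set.inter_subset_left hcompact.isClosed)⟩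
  nth_rewrite 1 [himage]
  rintro _ ⟨v, hv, rfl⟩
  refine ((hcont v hv).mono fun w hw => hw.1).mem_closure (stdSimplex_subset_closure_pos hv) ?_
  rintro w ⟨hw, hpos⟩
  refine ⟨⟨_, isProb_probOf hw, rfl⟩, fun ω => hs.ne_top (isProb_probOf hw) ?_⟩
  rw [probOf_singleton]
  exact (hpos ω).ne'
end
end
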